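/- There exists a constant C > 0 such that for every natural number n ≥ 1 there exist real polynomials p and q, each of degree at most n, with q(x) ≠ 0 for all x ∈ [−1, 1], such that sup_{x ∈ [−1,1]} | |x| − p(x)/q(x) | ≤ C·exp(−√n). That is, rational functions of type (n, n) approximate the absolute-value function on [−1, 1] with root-exponential accuracy — in sharp contrast to polynomials of degree n, whose best approximation error to |x| on [−1,1] decays only like 1/n. -/

import Mathlib

open Polynomial

/-- For `x` between `ξ ^ N` and `1`, the ratios of `x` to the nodes `ξ ^ k` dominate a
geometric sum. -/
lemma sum_pow_succ_le_sum_min_div {ξ : ℝ} (h0 : 0 < ξ) (h1 : ξ ≤ 1) {x : ℝ} (hx1 : x ≤ 1)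
    (N : ℕ) (hx : ξ ^ N ≤ x) :
    ∑ k ∈ Finset.range N, ξ ^ (k + 1) ≤
      ∑ k ∈ Finset.range N, min (ξ ^ k / x) (x / ξ ^ k) := by
  induction N with
  | zero => simp
  | succ N ih =>
    have hx0 : 0 < x := (pow_pos h0 _).trans_le hx
    have hle : ξ ^ (N + 1) ≤ ξ ^ N := pow_le_pow_of_le_one h0.le h1 (Nat.le_succ N)
    rcases le_total (ξ ^ N) x with h | h
    · rw [Finset.sum_range_succ, Finset.sum_range_succ]
      refine add_le_add (ih h) (le_min ?_ ?_)
      · rw [le_div_iff₀ hx0]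
        nlinarith [pow_pos h0 (N + 1)]
      · rw [le_div_iff₀ (pow_pos h0 _)]
        nlinarith [pow_pos h0 (N + 1), pow_le_one₀ h0.le h1 (n := N)]
    · rw [← Finset.sum_range_reflect]
      refine Finset.sum_le_sum fun k hk => ?_
      have hkN : k < N + 1 := Finset.mem_range.mp hk
      have hxk : x ≤ ξ ^ k := h.trans (pow_le_pow_of_le_one h0.le h1 (by omega))
      have hpk := pow_pos h0 k
      have hmain : ξ ^ (N + 1 - 1 - k + 1) ≤ x / ξ ^ k := by
        rwa [le_div_iff₀ hpk, ← pow_add, show N + 1 - 1 - k + 1 + k = N + 1 by omega]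
      refine le_min (hmain.trans ?_) hmain
      exact ((div_le_one hpk).2 hxk).trans ((one_le_div hx0).2 hxk)

lemma abs_sub_le_add_mul_exp_neg_min {a x : ℝ} (ha : 0 < a) (hx : 0 < x) :
    |x - a| ≤ (x + a) * Real.exp (-min (a / x) (x / a)) := by
  wlog h : a ≤ x generalizing a x
  · have := this hx ha (le_of_not_ge h)
    rwa [abs_sub_comm, add_comm, min_comm] at this
  rw [abs_of_nonneg (sub_nonneg.2 h)]
  have h1 : min (a / x) (x / a) ≤ a / x := min_le_left _ _
  have h2 : 1 - a / x ≤ Real.exp (-min (a / x) (x / a)) := by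
    linarith [Real.add_one_le_exp (-min (a / x) (x / a))]
  calc x - a = x * (1 - a / x) := by field_simp
    _ ≤ x * Real.exp (-min (a / x) (x / a)) := by gcongr
    _ ≤ _ := by gcongr; linarith

lemma abs_prod_sub_pow_le {ξ : ℝ} (h0 : 0 < ξ) (h1 : ξ ≤ 1) {x : ℝ} (hx1 : x ≤ 1)
    (N : ℕ) (hx : ξ ^ N ≤ x) :
    |∏ k ∈ Finset.range N, (x - ξ ^ k)| ≤
      (∏ k ∈ Finset.range N, (x + ξ ^ k)) *
        Real.exp (-∑ k ∈ Finset.range N, ξ ^ (k + 1)) := by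
  have hx0 : 0 < x := (pow_pos h0 _).trans_le hx
  calc |∏ k ∈ Finset.range N, (x - ξ ^ k)|
      = ∏ k ∈ Finset.range N, |x - ξ ^ k| := Finset.abs_prod _ _
    _ ≤ ∏ k ∈ Finset.range N, ((x + ξ ^ k) * Real.exp (-min (ξ ^ k / x) (x / ξ ^ k))) :=
        Finset.prod_le_prod (fun _ _ => abs_nonneg _)
          fun k _ => abs_sub_le_add_mul_exp_neg_min (pow_pos h0 k) hx0
    _ = (∏ k ∈ Finset.range N, (x + ξ ^ k)) *
          Real.exp (-∑ k ∈ Finset.range N, min (ξ ^ k / x) (x / ξ ^ k)) := by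
        rw [Finset.prod_mul_distrib, ← Real.exp_sum, Finset.sum_neg_distrib]
    _ ≤ _ := by
        gcongr ?_ * Real.exp (-?_)
        exact sum_pow_succ_le_sum_min_div h0 h1 hx1 N hx

lemma exp_neg_inv_sqrt_pow {m : ℕ} (hm : 0 < m) :
    Real.exp (-(√(m : ℝ))⁻¹) ^ m = Real.exp (-√(m : ℝ)) := by
  have hs : 0 < √(m : ℝ) := Real.sqrt_pos.2 (by exact_mod_cast hm)
  have hsq : √(m : ℝ) * √(m : ℝ) = m := Real.mul_self_sqrt (Nat.cast_nonneg m)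
  rw [← Real.exp_nat_mul]
  congr 1
  nth_rewrite 1 [← hsq]
  rw [mul_neg, mul_assoc, mul_inv_cancel₀ hs.ne', mul_one]

lemma sqrt_sub_two_le_sum_exp_pow {m : ℕ} (hm : 0 < m) :
    √(m : ℝ) - 2 ≤ ∑ k ∈ Finset.range m, Real.exp (-(√(m : ℝ))⁻¹) ^ (k + 1) := by
  have hs : 0 < √(m : ℝ) := Real.sqrt_pos.2 (by exact_mod_cast hm)
  have hpow := exp_neg_inv_sqrt_pow hm
  set s := √(m : ℝ)
  set ξ := Real.exp (-s⁻¹) with hξ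
  have h0 : 0 < ξ := Real.exp_pos _
  have h1 : ξ ≤ 1 := Real.exp_le_one_iff.2 (by simpa using hs.le)
  have hlow : 1 - s⁻¹ ≤ ξ := by linarith [Real.add_one_le_exp (-s⁻¹)]
  have hgeom : (∑ k ∈ Finset.range m, ξ ^ (k + 1)) * (1 - ξ) = ξ * (1 - ξ ^ m) := by
    rw [← geom_sum_mul_neg, ← mul_assoc, Finset.mul_sum]
    simp_rw [pow_succ']
  set S := ∑ k ∈ Finset.range m, ξ ^ (k + 1)
  have hS : 0 ≤ S := Finset.sum_nonneg fun k _ => by positivity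
  have hE : s * Real.exp (-s) ≤ 1 := by
    rw [Real.exp_neg, ← div_eq_mul_inv, div_le_one (Real.exp_pos _)]
    linarith [Real.add_one_le_exp s]
  have hss : s * s⁻¹ = 1 := mul_inv_cancel₀ hs.ne'
  rw [hpow] at hgeom
  have hS' : ξ * (1 - Real.exp (-s)) ≤ S * s⁻¹ := by
    rw [← hgeom]
    gcongr
    linarith
  have hlow' : s * (1 - s⁻¹ - Real.exp (-s)) ≤ s * (S * s⁻¹) := by
    gcongr
    nlinarith [Real.exp_pos (-s)]
  have : s * (S * s⁻¹) = S := by field_simp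
  nlinarith

/-- The error of Newman's approximant on the nonnegative half of the interval. -/
lemma newman_error_of_nonneg {m : ℕ} (hm : 16 ≤ m) (heven : Even m) {y : ℝ} (hy0 : 0 ≤ y)
    (hy1 : y ≤ 1) :
    let P := ∏ k ∈ Finset.range m, (y + Real.exp (-(√(m : ℝ))⁻¹) ^ k)
    let Q := ∏ k ∈ Finset.range m, (y - Real.exp (-(√(m : ℝ))⁻¹) ^ k)
    0 < P + Q ∧ |y - y * (P - Q) / (P + Q)| ≤ Real.exp 4 * Real.exp (-√(m : ℝ)) := by
  intro P Q
  have hm0 : 0 < m := by omega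
  have hs : 4 ≤ √(m : ℝ) := Real.le_sqrt_of_sq_le (by norm_num; exact_mod_cast hm)
  have hpow := exp_neg_inv_sqrt_pow hm0
  have hsum := sqrt_sub_two_le_sum_exp_pow hm0
  set s := √(m : ℝ)
  set ξ := Real.exp (-s⁻¹)
  have h0 : 0 < ξ := Real.exp_pos _
  have h1 : ξ ≤ 1 := Real.exp_le_one_iff.2 (by simp; linarith)
  have hP : 0 < P := Finset.prod_pos fun k _ => by positivity
  have he2 : (4 : ℝ) ≤ Real.exp 2 := by
    have h : Real.exp 2 = Real.exp 1 * Real.exp 1 := by rw [← Real.exp_add]; norm_num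
    nlinarith [Real.add_one_le_exp (1 : ℝ)]
  have hform : 0 < P + Q → |y - y * (P - Q) / (P + Q)| = 2 * y * |Q| / (P + Q) := by
    intro h
    have : y - y * (P - Q) / (P + Q) = 2 * y * Q / (P + Q) := by
      field_simp
      ring
    rw [this, abs_div, abs_mul, abs_of_pos h, abs_of_nonneg (by positivity : 0 ≤ 2 * y)]
  rcases le_total (ξ ^ m) y with h | h
  · have hQ : |Q| ≤ P * Real.exp (2 - s) :=
      (abs_prod_sub_pow_le h0 h1 hy1 m h).trans <| by
        gcongr
        linarith
    have hT : Real.exp (2 - s) ≤ 1 / 2 := by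
      have : Real.exp (2 - s) * Real.exp 2 ≤ 1 := by
        rw [← Real.exp_add]
        exact Real.exp_le_one_iff.2 (by linarith)
      nlinarith [Real.exp_pos (2 - s)]
    have hhalf : P / 2 ≤ P + Q := by
      nlinarith [neg_abs_le Q]
    have hpos : 0 < P + Q := by linarith
    refine ⟨hpos, ?_⟩
    rw [hform hpos, div_le_iff₀ hpos]
    have hsplit : Real.exp 4 * Real.exp (-s) = Real.exp 2 * Real.exp (2 - s) := by
      rw [← Real.exp_add, ← Real.exp_add]
      congr 1
      ring
    calc 2 * y * |Q| ≤ 2 * 1 * (P * Real.exp (2 - s)) := by gcongr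
      _ = 4 * Real.exp (2 - s) * (P / 2) := by ring
      _ ≤ Real.exp 2 * Real.exp (2 - s) * (P + Q) := by gcongr
      _ = _ := by rw [hsplit]
  · have hQ : 0 ≤ Q := by
      have : Q = ∏ k ∈ Finset.range m, (ξ ^ k - y) := by
        have hneg := Finset.prod_neg (s := Finset.range m) (f := fun k => y - ξ ^ k)
        simpa [heven.neg_one_pow] using hneg.symm
      rw [this]
      refine Finset.prod_nonneg fun k hk => sub_nonneg.2 (h.trans ?_)
      exact pow_le_pow_of_le_one h0.le h1 (Finset.mem_range.1 hk).le
    have hpos : 0 < P + Q := by linarith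
    refine ⟨hpos, ?_⟩
    rw [hform hpos, abs_of_nonneg hQ, div_le_iff₀ hpos]
    rw [hpow] at h
    calc 2 * y * Q ≤ 2 * y * (P + Q) := by gcongr; linarith
      _ ≤ Real.exp 4 * Real.exp (-s) * (P + Q) := by
        have : 2 * y ≤ Real.exp 4 * Real.exp (-s) := by
          nlinarith [Real.add_one_le_exp (4 : ℝ), Real.exp_pos (-s)]
        gcongr

/-- Newman's approximants of even degree. -/
lemma exists_newman_approx_of_even {m : ℕ} (hm : 16 ≤ m) (heven : Even m) :
    ∃ p q : ℝ[X], p.degree ≤ (m : WithBot ℕ) ∧ q.degree ≤ (m : WithBot ℕ) ∧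
      (∀ x ∈ Set.Icc (-1 : ℝ) 1, q.eval x ≠ 0) ∧
      ∀ x ∈ Set.Icc (-1 : ℝ) 1,
        |(|x| - p.eval x / q.eval x)| ≤ Real.exp 4 * Real.exp (-√(m : ℝ)) := by
  have herr := @newman_error_of_nonneg m hm heven
  set ξ := Real.exp (-(√(m : ℝ))⁻¹)
  let A : ℝ[X] := ∏ k ∈ Finset.range m, (X + C (ξ ^ k))
  let B : ℝ[X] := ∏ k ∈ Finset.range m, (X - C (ξ ^ k))
  have hA : A.Monic := monic_prod_of_monic _ _ fun k _ => monic_X_add_C _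
  have hB : B.Monic := monic_prod_of_monic _ _ fun k _ => monic_X_sub_C _
  have hAd : A.degree = m := by simp [A, degree_prod, -map_pow]
  have hBd : B.degree = m := by simp [B, degree_prod, -map_pow]
  have hsub : (A - B).degree < m :=
    hAd ▸ degree_sub_lt_left (hAd.trans hBd.symm) hA.ne_zero (by rw [hA.leadingCoeff, hB.leadingCoeff])
  have hAe : ∀ x, A.eval x = ∏ k ∈ Finset.range m, (x + ξ ^ k) := fun x => by
    simp [A, eval_prod]
  have hBe : ∀ x, B.eval x = ∏ k ∈ Finset.range m, (x - ξ ^ k) := fun x => by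
    simp [B, eval_prod]
  have hAB : ∀ x, A.eval (-x) = B.eval x := fun x => by
    have hneg := Finset.prod_neg (s := Finset.range m) (f := fun k => x - ξ ^ k)
    rw [hAe, hBe]
    simpa [heven.neg_one_pow, neg_add_eq_sub] using hneg
  have hall : ∀ x ∈ Set.Icc (-1 : ℝ) 1, 0 < (A + B).eval x ∧
      |(|x| - (X * (A - B)).eval x / (A + B).eval x)| ≤
        Real.exp 4 * Real.exp (-√(m : ℝ)) := by
    intro x hx
    simp only [eval_add, eval_mul, eval_sub, eval_X]
    rcases le_total 0 x with h | h
    · have := herr h hx.2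
      rw [abs_of_nonneg h, hAe, hBe]
      exact this
    · have := herr (neg_nonneg.2 h) (by linarith [hx.1])
      simp only [← hAe, ← hBe] at this
      rw [hAB, ← hAB (-x), neg_neg] at this
      rw [abs_of_nonpos h, add_comm (eval x A)]
      convert this using 5
      ring
  refine ⟨X * (A - B), A + B, ?_, ?_, fun x hx => (hall x hx).1.ne', fun x hx => (hall x hx).2⟩
  · rcases eq_or_ne (A - B) 0 with h | h
    · simp [h]
    · rw [← natDegree_lt_iff_degree_lt h] at hsub
      rw [← natDegree_le_iff_degree_le, natDegree_X_mul h]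
      exact hsub
  · exact (degree_add_le _ _).trans (by rw [hAd, hBd, max_self])

/-- **Newman's theorem: root-exponential rational approximation of `|x|`.**
There is a constant `C > 0` such that for every `n ≥ 1` there exist real polynomials
`p` and `q`, each of degree at most `n`, with `q` nonvanishing on `[−1, 1]`, such that
`| |x| − p(x)/q(x) | ≤ C · exp(−√n)` for all `x ∈ [−1, 1]`.  That is, rational
functions of type `(n, n)` approximate `|x|` on `[−1, 1]` with root-exponential
accuracy. -/
theorem newman_abs_rational_approximation :
    ∃ C : ℝ, 0 < C ∧ ∀ n : ℕ, 1 ≤ n →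
      ∃ p q : Polynomial ℝ,
        p.degree ≤ (n : WithBot ℕ) ∧ q.degree ≤ (n : WithBot ℕ) ∧
        (∀ x ∈ Set.Icc (-1 : ℝ) 1, q.eval x ≠ 0) ∧
        ∀ x ∈ Set.Icc (-1 : ℝ) 1,
          |(|x| - p.eval x / q.eval x)| ≤ C * Real.exp (-Real.sqrt n) := by
  refine ⟨Real.exp 5, Real.exp_pos 5, fun n _ => ?_⟩
  rcases lt_or_ge n 16 with hn | hn
  · refine ⟨0, 1, by simp, by simp [degree_one], by simp, fun x hx => ?_⟩
    have hs : √(n : ℝ) ≤ 4 := Real.sqrt_le_iff.2 ⟨by norm_num, by norm_num; exact_mod_cast hn.le⟩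
    rw [← Real.exp_add]
    simp only [eval_zero, zero_div, sub_zero, abs_abs]
    exact (abs_le.2 hx).trans (Real.one_le_exp (by linarith))
  · obtain ⟨p, q, hp, hq, hne, herr⟩ :=
      exists_newman_approx_of_even (m := 2 * (n / 2)) (by omega) (even_two_mul _)
    have hmn : ((2 * (n / 2) : ℕ) : WithBot ℕ) ≤ n := by
      exact_mod_cast (by omega : 2 * (n / 2) ≤ n)
    refine ⟨p, q, hp.trans hmn, hq.trans hmn, hne, fun x hx => (herr x hx).trans ?_⟩
    have hcast : (n : ℝ) ≤ (2 * (n / 2) : ℕ) + 1 := by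
      exact_mod_cast (by omega : n ≤ 2 * (n / 2) + 1)
    have hs : √(n : ℝ) ≤ √((2 * (n / 2) : ℕ) : ℝ) + 1 := by
      refine Real.sqrt_le_iff.2 ⟨by positivity, ?_⟩
      nlinarith [Real.sq_sqrt (Nat.cast_nonneg (α := ℝ) (2 * (n / 2))),
        Real.sqrt_nonneg ((2 * (n / 2) : ℕ) : ℝ)]
    rw [← Real.exp_add, ← Real.exp_add]
    exact Real.exp_le_exp.2 (by linarith)
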